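/- arXiv:2307.03144 — 6 statements merged into one kernel-verified Lean document; each statement's English description precedes it below -/
import Mathlib

section
/- Let n be a nonzero integer, d a positive integer with d ∤ n, r₂ ∈ ℝ, and Q ∈ ℤ with Q ≤ −3 − |r₂|. Then the following sums converge absolutely and ∑_{c∈ℕ} c^{r₂} ∑_{a,b∈ℤ∖{0}, ad−bc=n} (bc)^Q·log|bc| = (−1)^{Q+1}·σ_{r₂}(n)·n^Q·log|n| + ∑_{c∈ℕ, gcd(c,d)∣n} c^{r₂}·(cd/gcd(c,d))^Q·log(cd/gcd(c,d))·∑_{m∈ℤ}(m+u_{c,d})^Q + d^{r₂+2Q} ∑_{0<c'≤d, gcd(c',d)∣n} gcd(c',d)^{−Q}·ζ(−r₂−Q, c'/d)·∑_{m∈ℤ}(m+u_{c',d})^Q·log|m+u_{c',d}|. -/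
open scoped BigOperators

/-- The divisor function `σ_ν(m) = ∑_{d ∣ |m|} d^ν` for `ν ∈ ℂ` and `m ∈ ℤ`. -/
noncomputable def dsigma (ν : ℂ) (m : ℤ) : ℂ := ∑ d ∈ m.natAbs.divisors, (d : ℂ) ^ ν

/-- The Hurwitz zeta function `ζ(s, a)`, meromorphically continued in `s`. -/
noncomputable def hzeta (s : ℂ) (a : ℝ) : ℂ := HurwitzZeta.hurwitzZeta (a : UnitAddCircle) s

/-- `b` is an element of `B_{c,d} = {b : ∃ a, a·d − b·c = n}` of minimal absolute value. -/
def IsMinAbsB (n : ℤ) (c d : ℕ) (b : ℤ) : Prop :=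
  (∃ a : ℤ, a * d - b * c = n) ∧ ∀ b' : ℤ, (∃ a : ℤ, a * d - b' * c = n) → |b| ≤ |b'|

/-- `u_{c,d} = b*·gcd(c,d)/d`, given the minimizing element `b` of `B_{c,d}`. -/
noncomputable def uval (c d : ℕ) (b : ℤ) : ℝ := ((b * Nat.gcd c d : ℤ) : ℝ) / (d : ℝ)

lemma summable_int_add_zpow (u : ℝ) {Q : ℤ} (hQ : Q ≤ -2) :
    Summable fun m : ℤ => |((m : ℝ) + u) ^ Q| := by
  have h := (Real.summable_one_div_int_add_rpow u (-(Q : ℝ))).2 (by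
    have : (Q : ℝ) ≤ -2 := by exact_mod_cast hQ
    linarith)
  refine h.congr fun m => ?_
  rw [Real.rpow_neg (abs_nonneg _), Real.rpow_intCast, abs_zpow, one_div, inv_inv]

lemma abs_log_abs_le {x : ℝ} (hx : x ≠ 0) : |Real.log (|x|)| ≤ |x| + |x|⁻¹ := by
  have hpos := abs_pos.2 hx
  have h1 := Real.log_le_sub_one_of_pos hpos
  have h2 := Real.one_sub_inv_le_log_of_pos hpos
  have h3 := inv_pos.2 hpos
  exact abs_le.2 ⟨by linarith, by linarith⟩

lemma summable_int_add_zpow_mul_log (u : ℝ) {Q : ℤ} (hQ : Q ≤ -3) :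
    Summable fun m : ℤ => ((m : ℝ) + u) ^ Q * Real.log |(m : ℝ) + u| := by
  refine Summable.of_norm_bounded
    ((summable_int_add_zpow u (Q := Q + 1) (by omega)).add
      (summable_int_add_zpow u (Q := Q - 1) (by omega))) fun m => ?_
  rcases eq_or_ne ((m : ℝ) + u) 0 with h | h
  · rw [h]; simp; positivity
  · have := mul_le_mul_of_nonneg_left (abs_log_abs_le h) (abs_nonneg (((m : ℝ) + u) ^ Q))
    rw [zpow_add_one₀ h, zpow_sub_one₀ h, abs_mul, abs_mul, abs_inv, Real.norm_eq_abs, abs_mul]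
    linarith

lemma tsum_int_add_eq_of_sub_eq_int (f : ℝ → ℝ) {u v : ℝ} {k : ℤ} (h : u - v = k) :
    ∑' m : ℤ, f (m + u) = ∑' m : ℤ, f (m + v) := by
  rw [← (Equiv.addRight k).tsum_eq fun m : ℤ => f (m + v)]
  congr 1 with m
  rw [show u = v + k by linarith]
  simp only [Equiv.coe_addRight, Int.cast_add]
  ring_nf

lemma uval_sub_uval_eq_int {n : ℤ} {c c' d : ℕ} (hd : 0 < d) (hcc : (c : ℤ) ≡ c' [ZMOD d])
    {b b' : ℤ} (h : ∃ a : ℤ, a * d - b * c = n) (h' : ∃ a : ℤ, a * d - b' * c' = n) :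
    ∃ k : ℤ, uval c d b - uval c' d b' = k := by
  obtain ⟨a, ha⟩ := h
  obtain ⟨a', ha'⟩ := h'
  have hg : Nat.gcd c d = Nat.gcd c' d := ((Int.natCast_modEq_iff.1 hcc).gcd_eq)
  obtain ⟨t, ht⟩ := hcc.dvd
  have hdvd : (d : ℤ) ∣ (b - b') * Nat.gcd c d := by
    rw [Nat.gcd_eq_gcd_ab, show (b - b') * ((c : ℤ) * c.gcdA d + d * c.gcdB d) =
      ((b - b') * c) * c.gcdA d + d * ((b - b') * c.gcdB d) by ring]
    refine dvd_add (Dvd.dvd.mul_right ⟨a - a' + b' * t, ?_⟩ _) (dvd_mul_right _ _)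
    have : (c' : ℤ) = c + d * t := by linarith
    rw [this] at ha'
    linear_combination ha' - ha
  obtain ⟨k, hk⟩ := hdvd
  refine ⟨k, ?_⟩
  have hd' : (d : ℝ) ≠ 0 := by positivity
  rw [uval, uval, ← hg, ← sub_div, div_eq_iff hd', ← Int.cast_sub, ← sub_mul, hk]
  push_cast; ring

lemma hasSum_solutions {n : ℤ} {c d : ℕ} (hd : 0 < d) {a b : ℤ} (h : a * d - b * c = n)
    (f : ℤ → ℂ) {S : ℂ} (hf : HasSum (fun m : ℤ => f (b + (d / Nat.gcd c d : ℕ) * m)) S) :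
    HasSum (fun ab : ℤ × ℤ => if ab.1 * d - ab.2 * c = n then f ab.2 else 0) S := by
  have hg : 0 < Nat.gcd c d := Nat.gcd_pos_of_pos_right c hd
  obtain ⟨c₁, d₁, hcop, hc₁, hd₁⟩ := Nat.exists_coprime c d
  have hdiv : d / Nat.gcd c d = d₁ := Nat.div_eq_of_eq_mul_left hg hd₁
  rw [hdiv] at hf
  generalize Nat.gcd c d = g at hg hc₁ hd₁
  subst hc₁ hd₁
  push_cast at *
  have hg' : (g : ℤ) ≠ 0 := by exact_mod_cast hg.ne'
  have hd₁ : (d₁ : ℤ) ≠ 0 := by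
    rintro h0
    have : d₁ = 0 := by exact_mod_cast h0
    simp [this] at hd
  have hinj : Function.Injective fun m : ℤ => (a + c₁ * m, b + d₁ * m) := fun x y hxy => by
    have := congrArg Prod.snd hxy
    exact mul_left_cancel₀ hd₁ (add_left_cancel this)
  refine (hinj.hasSum_iff ?_).1 (hf.congr_fun fun m => ?_)
  · rintro ⟨x, y⟩ hxy
    refine if_neg fun hsol => hxy ?_
    have heq : (x - a) * d₁ = (y - b) * c₁ := by
      apply mul_right_cancel₀ hg'
      linear_combination hsol - h
    have hdvd : (d₁ : ℤ) ∣ y - b :=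
      (Nat.isCoprime_iff_coprime.2 hcop).symm.dvd_of_dvd_mul_right ⟨x - a, by rw [← heq]; ring⟩
    obtain ⟨k, hk⟩ := hdvd
    refine ⟨k, Prod.ext ?_ ?_⟩
    · apply mul_right_cancel₀ hd₁
      rw [hk] at heq
      linear_combination -heq
    · simp only; linear_combination -hk
  · exact if_pos (by simp only; linear_combination h)

lemma intCast_add_mul_mul_eq {c d : ℕ} (hd : 0 < d) (b m : ℤ) :
    (((b + (d / Nat.gcd c d : ℕ) * m) * c : ℤ) : ℝ) =
      ((c * d / Nat.gcd c d : ℕ) : ℝ) * (m + uval c d b) := by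
  have hg : 0 < Nat.gcd c d := Nat.gcd_pos_of_pos_right c hd
  obtain ⟨d₁, hd₁⟩ := Nat.gcd_dvd_right c d
  have hdiv : d / Nat.gcd c d = d₁ := Nat.div_eq_of_eq_mul_right hg hd₁
  have hg' : (Nat.gcd c d : ℝ) ≠ 0 := by positivity
  have hd' : (d : ℝ) ≠ 0 := by positivity
  have hd₁' : (d : ℝ) = Nat.gcd c d * d₁ := by exact_mod_cast hd₁
  rw [Nat.mul_div_assoc _ (Nat.gcd_dvd_right c d), uval, hdiv]
  push_cast
  field_simp
  rw [hd₁']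
  ring

lemma add_uval_ne_zero {n : ℤ} {c d : ℕ} (hd : 0 < d) (hdn : ¬ (d : ℤ) ∣ n) {b : ℤ}
    (h : ∃ a : ℤ, a * d - b * c = n) (m : ℤ) : (m : ℝ) + uval c d b ≠ 0 := by
  intro h0
  obtain ⟨a, ha⟩ := h
  have h1 := intCast_add_mul_mul_eq (c := c) hd b m
  rw [h0, mul_zero, Int.cast_eq_zero] at h1
  obtain ⟨c₁, hc₁⟩ := Nat.gcd_dvd_left c d
  have h2 : (d / Nat.gcd c d : ℕ) * (c : ℤ) = d * c₁ := by
    have : d / Nat.gcd c d * c = d * c₁ := by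
      conv_lhs => rw [hc₁]
      rw [← mul_assoc, ← hc₁, Nat.div_mul_cancel (Nat.gcd_dvd_right c d)]
    exact_mod_cast this
  exact hdn ⟨a + c₁ * m, by linear_combination -ha - h1 + m * h2⟩

/-- The sum over nonzero solutions is the sum over all solutions minus the solution with `a = 0`. -/
lemma hasSum_nonzero_solutions {n : ℤ} {c d : ℕ} (hc : 0 < c)
    (hdn : ¬ (d : ℤ) ∣ n) (f : ℤ → ℂ) {S : ℂ}
    (hf : HasSum (fun ab : ℤ × ℤ => if ab.1 * d - ab.2 * c = n then f (ab.2 * c) else 0) S) :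
    HasSum (fun ab : ℤ × ℤ =>
        if ab.1 ≠ 0 ∧ ab.2 ≠ 0 ∧ ab.1 * d - ab.2 * c = n then f (ab.2 * c) else 0)
      (S - if (c : ℤ) ∣ n then f (-n) else 0) := by
  have hc' : (c : ℤ) ≠ 0 := by exact_mod_cast hc.ne'
  have hH : HasSum (fun ab : ℤ × ℤ =>
      if ab.1 = 0 ∧ ab.1 * d - ab.2 * c = n then f (ab.2 * c) else 0)
      (if (c : ℤ) ∣ n then f (-n) else 0) := by
    split_ifs with hdvd
    · obtain ⟨k, rfl⟩ := hdvd
      convert hasSum_ite_eq ((0 : ℤ), -k) (f (-(c * k))) using 2 with ab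
      obtain ⟨x, y⟩ := ab
      have : (x = 0 ∧ x * d - y * c = c * k) ↔ (x, y) = (0, -k) := by
        rw [Prod.mk.injEq]
        refine and_congr_right fun hx => ?_
        subst hx
        constructor
        · intro h
          apply mul_left_cancel₀ hc'
          linear_combination -h
        · rintro rfl; ring
      simp only [this]
      split_ifs with hxy
      · rw [(Prod.mk.inj hxy).2]; congr 1; ring
      · rfl
    · convert hasSum_zero using 2 with ab
      refine if_neg fun h => hdvd ⟨-ab.2, ?_⟩
      have := h.2
      rw [h.1] at this
      linear_combination -this
  refine (hf.sub hH).congr_fun fun ⟨x, y⟩ => ?_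
  by_cases hs : x * d - y * c = n
  · have hy : y ≠ 0 := by
      rintro rfl
      exact hdn ⟨x, by linear_combination -hs⟩
    by_cases hx : x = 0 <;> simp [hs, hx, hy]
  · simp [hs]

lemma hasSum_zpow_mul_log_solutions {n : ℤ} {c d : ℕ} (hc : 0 < c) (hd : 0 < d)
    (hdn : ¬ (d : ℤ) ∣ n) {Q : ℤ} (hQ : Q ≤ -3) {b : ℤ} (h : ∃ a : ℤ, a * d - b * c = n) :
    HasSum (fun ab : ℤ × ℤ => if ab.1 * d - ab.2 * c = n then
        ((ab.2 * c : ℤ) : ℂ) ^ Q * (Real.log |((ab.2 * c : ℤ) : ℝ)| : ℂ) else 0)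
      (((c * d / Nat.gcd c d : ℕ) : ℂ) ^ Q * (Real.log ((c * d / Nat.gcd c d : ℕ) : ℝ) : ℂ) *
          ((∑' m : ℤ, ((m : ℝ) + uval c d b) ^ Q : ℝ) : ℂ) +
        ((c * d / Nat.gcd c d : ℕ) : ℂ) ^ Q *
          ((∑' m : ℤ, ((m : ℝ) + uval c d b) ^ Q * Real.log |(m : ℝ) + uval c d b| : ℝ) : ℂ)) := by
  obtain ⟨a, ha⟩ := h
  have hL : 0 < c * d / Nat.gcd c d :=
    Nat.div_pos (Nat.le_of_dvd (by positivity) ((Nat.gcd_dvd_left c d).mul_right d))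
      (Nat.gcd_pos_of_pos_right c hd)
  refine hasSum_solutions hd ha
    (fun y => ((y * c : ℤ) : ℂ) ^ Q * (Real.log |((y * c : ℤ) : ℝ)| : ℂ)) ?_
  have h1 := Complex.hasSum_ofReal.2 (summable_int_add_zpow (uval c d b) (Q := Q)
    (by omega)).of_abs.hasSum
  have h2 := Complex.hasSum_ofReal.2 (summable_int_add_zpow_mul_log (uval c d b) hQ).hasSum
  refine ((h1.mul_left _).add (h2.mul_left _)).congr_fun fun m => ?_
  have hne := add_uval_ne_zero hd hdn ⟨a, ha⟩ m
  have hL' : ((c * d / Nat.gcd c d : ℕ) : ℝ) ≠ 0 := by positivity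
  rw [← Complex.ofReal_intCast, intCast_add_mul_mul_eq hd, abs_mul,
    Real.log_mul (abs_ne_zero.2 hL') (abs_ne_zero.2 hne), Nat.abs_cast, Complex.ofReal_mul,
    mul_zpow]
  push_cast
  ring

/-- A sum over `ℤ` shifted by `u_{c,d}` depends only on `c` modulo `d`. -/
lemma tsum_add_uval_eq {n : ℤ} {c c' d : ℕ} (hd : 0 < d) (hcc : (c : ℤ) ≡ c' [ZMOD d])
    {b b' : ℤ} (h : ∃ a : ℤ, a * d - b * c = n) (h' : ∃ a : ℤ, a * d - b' * c' = n)
    (f : ℝ → ℝ) :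
    ∑' m : ℤ, f (m + uval c d b) = ∑' m : ℤ, f (m + uval c' d b') := by
  obtain ⟨k, hk⟩ := uval_sub_uval_eq_int hd hcc h h'
  exact tsum_int_add_eq_of_sub_eq_int f hk

lemma exists_abs_tsum_add_uval_le {n : ℤ} {d : ℕ} (hd : 0 < d) {bstar : ℕ → ℤ}
    (hb : ∀ c : ℕ, 0 < c → (Nat.gcd c d : ℤ) ∣ n → ∃ a : ℤ, a * d - bstar c * c = n)
    (f : ℝ → ℝ) :
    ∃ M : ℝ, ∀ c : ℕ, 0 < c → (Nat.gcd c d : ℤ) ∣ n →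
      |∑' m : ℤ, f (m + uval c d (bstar c))| ≤ M := by
  refine ⟨∑ i ∈ Finset.Icc 1 d, |∑' m : ℤ, f (m + uval i d (bstar i))|,
    fun c hc hcn => ?_⟩
  obtain ⟨i, hi, hci⟩ : ∃ i ∈ Finset.Icc 1 d, c ≡ i [MOD d] := by
    refine ⟨(c - 1) % d + 1, Finset.mem_Icc.2 ⟨by omega, Nat.mod_lt _ hd⟩, ?_⟩
    have := (Nat.mod_modEq (c - 1) d).symm.add_right 1
    rwa [Nat.sub_add_cancel hc] at this
  have hi0 : 0 < i := (Finset.mem_Icc.1 hi).1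
  have hin : (Nat.gcd i d : ℤ) ∣ n := by rwa [← hci.gcd_eq]
  rw [tsum_add_uval_eq hd (Int.natCast_modEq_iff.2 hci) (hb c hc hcn) (hb i hi0 hin) f]
  exact Finset.single_le_sum (f := fun i => |∑' m : ℤ, f (m + uval i d (bstar i))|)
    (fun _ _ => abs_nonneg _) hi

lemma summable_cpow_mul_zpow_mul {n : ℤ} {d : ℕ} (hd : 0 < d) {r : ℝ} {Q : ℤ} (hQ0 : Q ≤ 0)
    (hrQ : r + Q ≤ -3) {w : ℕ → ℝ} {E : ℕ → ℝ} {M : ℝ}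
    (hw : ∀ c : ℕ, 0 < c → |w c| ≤ c * d)
    (hE : ∀ c : ℕ, 0 < c → (Nat.gcd c d : ℤ) ∣ n → |E c| ≤ M) :
    Summable fun c : ℕ => if 0 < c ∧ (Nat.gcd c d : ℤ) ∣ n then
      (c : ℂ) ^ (r : ℂ) * ((c * d / Nat.gcd c d : ℕ) : ℂ) ^ Q * (w c : ℂ) * (E c : ℂ) else 0 := by
  have hs := (Real.summable_nat_rpow (p := -2)).2 (by norm_num)
  refine Summable.of_norm_bounded (hs.mul_right (d * |M|)) fun c => ?_
  split_ifs with h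
  · obtain ⟨hc, hcn⟩ := h
    have hc0 : (0 : ℝ) < c := by exact_mod_cast hc
    have hc1 : (1 : ℝ) ≤ c := by exact_mod_cast hc
    have hg := Nat.gcd_pos_of_pos_right c hd
    have hL : c ≤ c * d / Nat.gcd c d := by
      rw [Nat.le_div_iff_mul_le hg]
      exact Nat.mul_le_mul_left _ (Nat.gcd_le_right c hd)
    have hL' : (c : ℝ) ≤ (c * d / Nat.gcd c d : ℕ) := by exact_mod_cast hL
    have h1 : ((c * d / Nat.gcd c d : ℕ) : ℝ) ^ Q ≤ (c : ℝ) ^ Q :=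
      by
      obtain ⟨q, hq⟩ := Int.eq_ofNat_of_zero_le (neg_nonneg.2 hQ0)
      rw [show Q = -(q : ℤ) by omega, zpow_neg, zpow_neg, zpow_natCast, zpow_natCast]
      gcongr
    have h2 : (c : ℝ) ^ r * (c : ℝ) ^ Q ≤ (c : ℝ) ^ (-3 : ℝ) := by
      rw [← Real.rpow_intCast, ← Real.rpow_add hc0]
      exact Real.rpow_le_rpow_of_exponent_le hc1 hrQ
    rw [norm_mul, norm_mul, norm_mul, norm_zpow, Complex.norm_natCast, Complex.norm_real,
      Complex.norm_real, Complex.norm_natCast_cpow_of_pos hc, Complex.ofReal_re]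
    calc (c : ℝ) ^ r * ((c * d / Nat.gcd c d : ℕ) : ℝ) ^ Q * |w c| * |E c|
        ≤ (c : ℝ) ^ r * (c : ℝ) ^ Q * (c * d) * |M| := by
          have h3 := hw c hc
          have h4 := (hE c hc hcn).trans (le_abs_self M)
          gcongr (c : ℝ) ^ r * ?_ * ?_ * ?_
      _ ≤ (c : ℝ) ^ (-3 : ℝ) * (c * d) * |M| := by gcongr
      _ = (c : ℝ) ^ (-2 : ℝ) * (d * |M|) := by
          rw [show (-2 : ℝ) = -3 + 1 by norm_num, Real.rpow_add hc0, Real.rpow_one]; ring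
  · rw [norm_zero]; positivity

lemma hzeta_tsum_residue {c d : ℕ} (hc : 0 < c) (hcd : c ≤ d) {r : ℝ} {Q : ℤ}
    (hrQ : r + Q ≤ -3) :
    ∑' k : ℕ, ((c + d * k : ℕ) : ℂ) ^ (r : ℂ) *
        (((c + d * k) * d / Nat.gcd (c + d * k) d : ℕ) : ℂ) ^ Q =
      (d : ℂ) ^ ((r : ℂ) + 2 * (Q : ℂ)) *
        ((Nat.gcd c d : ℂ) ^ (-Q) * hzeta (-(r : ℂ) - (Q : ℂ)) ((c : ℝ) / d)) := by
  have hd : 0 < d := hc.trans_le hcd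
  have hd' : (0 : ℝ) < d := by exact_mod_cast hd
  have hdC : (d : ℂ) ≠ 0 := by exact_mod_cast hd.ne'
  have hz := HurwitzZeta.hasSum_hurwitzZeta_of_one_lt_re (a := (c : ℝ) / d)
    ⟨by positivity, (div_le_one hd').2 (by exact_mod_cast hcd)⟩ (s := -(r : ℂ) - (Q : ℂ))
    (by simp; linarith)
  rw [hzeta, ← hz.tsum_eq, ← tsum_mul_left, ← tsum_mul_left]
  congr 1 with k
  have hgcd : Nat.gcd (c + d * k) d = Nat.gcd c d := by simp
  have hgdvd : Nat.gcd c d ∣ c + d * k := hgcd ▸ Nat.gcd_dvd_left (c + d * k) d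
  have hg : (Nat.gcd c d : ℂ) ≠ 0 := by exact_mod_cast (Nat.gcd_pos_of_pos_right c hd).ne'
  have hx : (0 : ℝ) ≤ k + (c : ℝ) / d := by positivity
  have hxC : ((k + (c : ℝ) / d : ℝ) : ℂ) ≠ 0 := by
    have : (0 : ℝ) < k + (c : ℝ) / d := by positivity
    exact_mod_cast this.ne'
  have hcast : ((c + d * k : ℕ) : ℂ) = ((d : ℝ) : ℂ) * ((k + (c : ℝ) / d : ℝ) : ℂ) := by
    push_cast; field_simp; ring
  rw [hgcd, Nat.cast_div (hgdvd.mul_right d) hg, Nat.cast_mul,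
    hcast, Complex.mul_cpow_ofReal_nonneg hd'.le hx,
    show ((k : ℂ) + ((c : ℝ) / d : ℝ)) = ((k + (c : ℝ) / d : ℝ) : ℂ) by push_cast; rfl,
    show -(r : ℂ) - (Q : ℂ) = -((r : ℂ) + Q) by ring, Complex.cpow_neg, one_div, inv_inv,
    Complex.cpow_add _ _ hxC, Complex.cpow_add _ _ hdC,
    show 2 * (Q : ℂ) = ((2 * Q : ℤ) : ℂ) by push_cast; ring, Complex.cpow_intCast,
    Complex.cpow_intCast, two_mul, zpow_add₀ hdC, div_zpow, mul_zpow, mul_zpow, zpow_neg,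
    Complex.ofReal_natCast]
  ring

lemma tsum_eq_sum_Icc_tsum_residue {f : ℕ → ℂ} (hf : Summable f) (hf0 : f 0 = 0) {d : ℕ}
    (hd : 0 < d) : ∑' c, f c = ∑ c ∈ Finset.Icc 1 d, ∑' k : ℕ, f (c + d * k) := by
  obtain ⟨d, rfl⟩ : ∃ e, d = e + 1 := ⟨d - 1, by omega⟩
  rw [hf.tsum_eq_zero_add, hf0, zero_add,
    Nat.sumByResidueClasses ((summable_nat_add_iff 1).2 hf) (d + 1),
    ← Finset.Ico_add_one_right_eq_Icc, Finset.sum_Ico_eq_sum_range, Nat.add_sub_cancel,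
    ← Fin.sum_univ_eq_sum_range fun c => ∑' k : ℕ, f (1 + c + (d + 1) * k)]
  refine Finset.sum_congr rfl fun j _ => tsum_congr fun m => congrArg f ?_
  have hj : ZMod.val j = Fin.val j := rfl
  rw [hj]
  ring

/-- Lemma 3.3 of the paper, case `d ∤ n`: for `n ≠ 0`, `d ∤ n`, `r₂ ∈ ℝ` and
`Q ∈ ℤ` with `Q ≤ −3−|r₂|`, the sums converge absolutely and
`∑_{c∈ℕ} c^{r₂} ∑_{a,b∈ℤ∖{0}, ad−bc=n} (bc)^Q·log|bc|
  = (−1)^{Q+1}·σ_{r₂}(n)·n^Q·log|n|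
    + ∑_{c∈ℕ, gcd(c,d)∣n} c^{r₂}·(cd/gcd(c,d))^Q·log(cd/gcd(c,d))·∑_{m∈ℤ}(m+u_{c,d})^Q
    + d^{r₂+2Q} ∑_{0<c'≤d, gcd(c',d)∣n} gcd(c',d)^{−Q}·ζ(−r₂−Q, c'/d)·
        ∑_{m∈ℤ}(m+u_{c',d})^Q·log|m+u_{c',d}|`. -/
theorem shifted_sum_lemma_log_not_dvd (n : ℤ) (hn : n ≠ 0) (d : ℕ) (hd : 0 < d)
    (hdn : ¬ (d : ℤ) ∣ n) (r₂ : ℝ) (Q : ℤ) (hQ : (Q : ℝ) ≤ -3 - |r₂|)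
    (bstar : ℕ → ℤ)
    (hb : ∀ c : ℕ, 0 < c → (Nat.gcd c d : ℤ) ∣ n → IsMinAbsB n c d (bstar c)) :
    (∀ c : ℕ, 0 < c → Summable (fun ab : ℤ × ℤ =>
        if ab.1 ≠ 0 ∧ ab.2 ≠ 0 ∧ ab.1 * d - ab.2 * c = n
          then ((ab.2 * c : ℤ) : ℂ) ^ Q * (Real.log |((ab.2 * c : ℤ) : ℝ)| : ℂ) else 0)) ∧
    Summable (fun c : ℕ => if 0 < c then (c : ℂ) ^ (r₂ : ℂ) *
        ∑' ab : ℤ × ℤ, (if ab.1 ≠ 0 ∧ ab.2 ≠ 0 ∧ ab.1 * d - ab.2 * c = n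
          then ((ab.2 * c : ℤ) : ℂ) ^ Q * (Real.log |((ab.2 * c : ℤ) : ℝ)| : ℂ) else 0)
      else 0) ∧
    (∀ c : ℕ, 0 < c → (Nat.gcd c d : ℤ) ∣ n →
      Summable (fun m : ℤ => ((m : ℝ) + uval c d (bstar c)) ^ Q) ∧
      Summable (fun m : ℤ =>
        ((m : ℝ) + uval c d (bstar c)) ^ Q * Real.log |(m : ℝ) + uval c d (bstar c)|)) ∧
    Summable (fun c : ℕ => if 0 < c ∧ (Nat.gcd c d : ℤ) ∣ n then
        (c : ℂ) ^ (r₂ : ℂ) * ((c * d / Nat.gcd c d : ℕ) : ℂ) ^ Q *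
          (Real.log ((c * d / Nat.gcd c d : ℕ) : ℝ) : ℂ) *
          ((∑' m : ℤ, ((m : ℝ) + uval c d (bstar c)) ^ Q : ℝ) : ℂ) else 0) ∧
    (∑' c : ℕ, if 0 < c then (c : ℂ) ^ (r₂ : ℂ) *
        ∑' ab : ℤ × ℤ, (if ab.1 ≠ 0 ∧ ab.2 ≠ 0 ∧ ab.1 * d - ab.2 * c = n
          then ((ab.2 * c : ℤ) : ℂ) ^ Q * (Real.log |((ab.2 * c : ℤ) : ℝ)| : ℂ) else 0)
      else 0) =
      (-1 : ℂ) ^ (Q + 1) * dsigma (r₂ : ℂ) n * (n : ℂ) ^ Q * (Real.log |(n : ℝ)| : ℂ)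
      + (∑' c : ℕ, if 0 < c ∧ (Nat.gcd c d : ℤ) ∣ n then
          (c : ℂ) ^ (r₂ : ℂ) * ((c * d / Nat.gcd c d : ℕ) : ℂ) ^ Q *
            (Real.log ((c * d / Nat.gcd c d : ℕ) : ℝ) : ℂ) *
            ((∑' m : ℤ, ((m : ℝ) + uval c d (bstar c)) ^ Q : ℝ) : ℂ) else 0)
      + (d : ℂ) ^ ((r₂ : ℂ) + 2 * (Q : ℂ)) *
          ∑ c' ∈ Finset.Icc 1 d, (if (Nat.gcd c' d : ℤ) ∣ n then
            (Nat.gcd c' d : ℂ) ^ (-Q) * hzeta (-(r₂ : ℂ) - (Q : ℂ)) ((c' : ℝ) / d) *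
              ((∑' m : ℤ, ((m : ℝ) + uval c' d (bstar c')) ^ Q *
                Real.log |(m : ℝ) + uval c' d (bstar c')| : ℝ) : ℂ) else 0) := by
  have hsol : ∀ c : ℕ, 0 < c → (Nat.gcd c d : ℤ) ∣ n → ∃ a : ℤ, a * d - bstar c * c = n :=
    fun c hc hcn => (hb c hc hcn).1
  have hQ3 : Q ≤ -3 := by
    have : (Q : ℝ) ≤ -3 := by linarith [abs_nonneg r₂]
    exact_mod_cast this
  have hrQ : r₂ + Q ≤ -3 := by linarith [le_abs_self r₂]
  let V : ℕ → ℂ := fun c => if 0 < c ∧ (Nat.gcd c d : ℤ) ∣ n then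
    (c : ℂ) ^ (r₂ : ℂ) * ((c * d / Nat.gcd c d : ℕ) : ℂ) ^ Q *
      (Real.log ((c * d / Nat.gcd c d : ℕ) : ℝ) : ℂ) *
      ((∑' m : ℤ, ((m : ℝ) + uval c d (bstar c)) ^ Q : ℝ) : ℂ) else 0
  let W : ℕ → ℂ := fun c => if 0 < c ∧ (Nat.gcd c d : ℤ) ∣ n then
    (c : ℂ) ^ (r₂ : ℂ) * ((c * d / Nat.gcd c d : ℕ) : ℂ) ^ Q *
      ((∑' m : ℤ, ((m : ℝ) + uval c d (bstar c)) ^ Q *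
        Real.log |(m : ℝ) + uval c d (bstar c)| : ℝ) : ℂ) else 0
  let f : ℤ → ℂ := fun x => (x : ℂ) ^ Q * (Real.log |(x : ℝ)| : ℂ)
  let Z : ℕ → ℂ := fun c => if c ∈ n.natAbs.divisors then (c : ℂ) ^ (r₂ : ℂ) * f (-n) else 0
  have hinner : ∀ c : ℕ, 0 < c → ∃ S : ℂ, HasSum (fun ab : ℤ × ℤ =>
      if ab.1 ≠ 0 ∧ ab.2 ≠ 0 ∧ ab.1 * d - ab.2 * c = n
        then ((ab.2 * c : ℤ) : ℂ) ^ Q * (Real.log |((ab.2 * c : ℤ) : ℝ)| : ℂ) else 0) S ∧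
      (c : ℂ) ^ (r₂ : ℂ) * S = V c + W c - Z c := by
    intro c hc
    have hZ : Z c = (c : ℂ) ^ (r₂ : ℂ) * if (c : ℤ) ∣ n then f (-n) else 0 := by
      simp only [Z, Nat.mem_divisors, Int.natCast_dvd, mul_ite, mul_zero, Int.natAbs_ne_zero.2 hn,
        ne_eq, not_false_eq_true, and_true]
    by_cases hcn : (Nat.gcd c d : ℤ) ∣ n
    · refine ⟨_, hasSum_nonzero_solutions hc hdn f
        (hasSum_zpow_mul_log_solutions hc hd hdn hQ3 (hsol c hc hcn)), ?_⟩
      rw [hZ]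
      simp only [V, W, hc, hcn, and_self, if_true]
      ring
    · refine ⟨_, hasSum_nonzero_solutions hc hdn f (S := 0) ?_, ?_⟩
      · refine hasSum_zero.congr_fun fun ab => if_neg fun h => hcn ?_
        rw [← h]
        exact dvd_sub
          ((Int.natCast_dvd_natCast.2 (Nat.gcd_dvd_right c d)).mul_left _)
          ((Int.natCast_dvd_natCast.2 (Nat.gcd_dvd_left c d)).mul_left _)
      · rw [hZ]
        simp [V, W, hcn]
  have hLle : ∀ c : ℕ, 0 < c → |Real.log ((c * d / Nat.gcd c d : ℕ) : ℝ)| ≤ c * d := by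
    intro c hc
    rw [abs_of_nonneg (Real.log_natCast_nonneg _)]
    refine (Real.log_le_self (Nat.cast_nonneg _)).trans ?_
    exact_mod_cast Nat.div_le_self (c * d) (Nat.gcd c d)
  have hone : ∀ c : ℕ, 0 < c → |(1 : ℝ)| ≤ c * d := by
    intro c hc
    rw [abs_one]
    exact_mod_cast Nat.mul_pos hc hd
  have hV : Summable V := by
    obtain ⟨M, hM⟩ := exists_abs_tsum_add_uval_le hd hsol fun x => x ^ Q
    exact summable_cpow_mul_zpow_mul hd (by omega) hrQ hLle hM
  have hW : Summable W := by
    obtain ⟨M, hM⟩ := exists_abs_tsum_add_uval_le hd hsol fun x => x ^ Q * Real.log |x|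
    simpa [W] using summable_cpow_mul_zpow_mul hd (by omega) hrQ hone hM
  have hZ : HasSum Z (∑ c ∈ n.natAbs.divisors, (c : ℂ) ^ (r₂ : ℂ) * f (-n)) := by
    have h : HasSum Z (∑ c ∈ n.natAbs.divisors, Z c) :=
      hasSum_sum_of_ne_finset_zero fun c hc => if_neg hc
    rwa [Finset.sum_congr rfl fun c hc => if_pos hc] at h
  have hWsum : ∑' c, W c = (d : ℂ) ^ ((r₂ : ℂ) + 2 * (Q : ℂ)) *
      ∑ c' ∈ Finset.Icc 1 d, (if (Nat.gcd c' d : ℤ) ∣ n then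
        (Nat.gcd c' d : ℂ) ^ (-Q) * hzeta (-(r₂ : ℂ) - (Q : ℂ)) ((c' : ℝ) / d) *
          ((∑' m : ℤ, ((m : ℝ) + uval c' d (bstar c')) ^ Q *
            Real.log |(m : ℝ) + uval c' d (bstar c')| : ℝ) : ℂ) else 0) := by
    rw [tsum_eq_sum_Icc_tsum_residue hW (by simp [W]) hd, Finset.mul_sum]
    refine Finset.sum_congr rfl fun c hc => ?_
    obtain ⟨hc1, hcd⟩ := Finset.mem_Icc.1 hc
    have hgcd : ∀ k, Nat.gcd (c + d * k) d = Nat.gcd c d := by simp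
    split_ifs with hcn
    · rw [← mul_assoc, ← hzeta_tsum_residue hc1 hcd hrQ, ← tsum_mul_right]
      refine tsum_congr fun k => ?_
      have hck : 0 < c + d * k := by omega
      have hckn : (Nat.gcd (c + d * k) d : ℤ) ∣ n := by rwa [hgcd]
      have hmod : ((c + d * k : ℕ) : ℤ) ≡ c [ZMOD d] := by
        rw [Int.natCast_modEq_iff]; simp [Nat.ModEq]
      have h := tsum_add_uval_eq hd hmod (hsol _ hck hckn) (hsol c hc1 hcn)
        fun x => x ^ Q * Real.log |x|
      simp only [W]
      rw [if_pos ⟨hck, hckn⟩, h]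
    · rw [mul_zero]
      refine (tsum_congr fun k => ?_).trans tsum_zero
      simp only [W, hgcd, hcn, and_false, if_false]
  have houter : HasSum (fun c : ℕ => if 0 < c then (c : ℂ) ^ (r₂ : ℂ) *
        ∑' ab : ℤ × ℤ, (if ab.1 ≠ 0 ∧ ab.2 ≠ 0 ∧ ab.1 * d - ab.2 * c = n
          then ((ab.2 * c : ℤ) : ℂ) ^ Q * (Real.log |((ab.2 * c : ℤ) : ℝ)| : ℂ) else 0)
      else 0) (∑' c, V c + ∑' c, W c - ∑ c ∈ n.natAbs.divisors, (c : ℂ) ^ (r₂ : ℂ) * f (-n)) := by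
    refine ((hV.hasSum.add hW.hasSum).sub hZ).congr_fun fun c => ?_
    rcases Nat.eq_zero_or_pos c with rfl | hc
    · simp [V, W, Z]
    · obtain ⟨S, hS, hS'⟩ := hinner c hc
      rw [if_pos hc, hS.tsum_eq, hS']
  refine ⟨fun c hc => ?_, houter.summable, fun c _ _ =>
    ⟨(summable_int_add_zpow _ (by omega)).of_abs, summable_int_add_zpow_mul_log _ hQ3⟩, hV, ?_⟩
  · obtain ⟨S, hS, -⟩ := hinner c hc
    exact hS.summable
  · rw [houter.tsum_eq, hWsum, ← Finset.sum_mul]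
    have hfn : f (-n) = (-1 : ℂ) ^ Q * (n : ℂ) ^ Q * (Real.log |(n : ℝ)| : ℂ) := by
      simp only [f]
      rw [Int.cast_neg, Int.cast_neg, abs_neg, neg_eq_neg_one_mul, mul_zpow]
    rw [hfn, zpow_add_one₀ (by norm_num), dsigma]
    simp only [V]
    ring
end

section
/- Let d be a positive integer and s ∈ ℂ with Re(s) > 1. Then ∑_{c=1}^∞ log(gcd(c,d))·c^{−s} = ζ(s)·∑_{ℓ∈ℕ, ℓ∣d} Λ(ℓ)·ℓ^{−s}, where both sides converge absolutely. -/
open scoped BigOperators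

/-- Convolving `1` with `Λ` restricted to the divisors of `d` gives `n ↦ log (gcd n d)`. -/
theorem one_convolution_vonMangoldt_indicator_divisors {d n : ℕ} (hd : d ≠ 0) (hn : n ≠ 0) :
    LSeries.convolution 1
      (fun ℓ => if ℓ ∈ d.divisors then (ArithmeticFunction.vonMangoldt ℓ : ℂ) else 0) n =
      (Real.log (Nat.gcd n d) : ℂ) := by
  have hdiv : n.divisors.filter (· ∈ d.divisors) = (Nat.gcd n d).divisors := by
    ext ℓ
    simp [hd, hn, Nat.dvd_gcd_iff]
  rw [LSeries.convolution_def]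
  simp only [Pi.one_apply, one_mul]
  rw [Nat.sum_divisorsAntidiagonal' (f := fun _ ℓ =>
      if ℓ ∈ d.divisors then (ArithmeticFunction.vonMangoldt ℓ : ℂ) else 0),
    ← Finset.sum_filter, hdiv, ← ArithmeticFunction.vonMangoldt_sum, Complex.ofReal_sum]

/-- The Dirichlet series of a function supported on a finite set is a finite sum. -/
theorem LSeriesHasSum_indicator_finset (S : Finset ℕ) (hS : 0 ∉ S) (f : ℕ → ℂ) (s : ℂ) :
    LSeriesHasSum (fun n => if n ∈ S then f n else 0) s (∑ n ∈ S, f n * (n : ℂ) ^ (-s)) := by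
  have hterm : ∑ n ∈ S, f n * (n : ℂ) ^ (-s) =
      ∑ n ∈ S, LSeries.term (fun n => if n ∈ S then f n else 0) s n := by
    refine Finset.sum_congr rfl fun n hn => ?_
    rw [LSeries.term_of_ne_zero (ne_of_mem_of_not_mem hn hS), if_pos hn, Complex.cpow_neg,
      div_eq_mul_inv]
  rw [hterm]
  refine hasSum_sum_of_ne_finset_zero fun n hn => ?_
  simp [LSeries.term_def, hn]

/-- For a positive integer `d` and `s ∈ ℂ` with `Re(s) > 1`,
`∑_{c=1}^∞ log(gcd(c,d))·c^{−s} = ζ(s)·∑_{ℓ∣d} Λ(ℓ)·ℓ^{−s}`, with absolute convergence. -/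
theorem dirichlet_series_log_gcd (d : ℕ) (hd : 0 < d) (s : ℂ) (hs : 1 < s.re) :
    Summable (fun c : ℕ => if 0 < c then
        (Real.log (Nat.gcd c d) : ℂ) * (c : ℂ) ^ (-s) else 0) ∧
    (∑' c : ℕ, if 0 < c then (Real.log (Nat.gcd c d) : ℂ) * (c : ℂ) ^ (-s) else 0) =
      riemannZeta s * ∑ ℓ ∈ d.divisors, (ArithmeticFunction.vonMangoldt ℓ : ℂ) * (ℓ : ℂ) ^ (-s) := by
  have hsum := (LSeriesHasSum_one hs).convolution
    (LSeriesHasSum_indicator_finset d.divisors (by simp)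
      (fun ℓ => (ArithmeticFunction.vonMangoldt ℓ : ℂ)) s)
  have hterm : (fun c : ℕ => if 0 < c then
      (Real.log (Nat.gcd c d) : ℂ) * (c : ℂ) ^ (-s) else 0) =
      LSeries.term (LSeries.convolution 1 (fun ℓ => if ℓ ∈ d.divisors then
        (ArithmeticFunction.vonMangoldt ℓ : ℂ) else 0)) s := by
    funext c
    rcases eq_or_ne c 0 with rfl | hc
    · simp
    · rw [if_pos (Nat.pos_of_ne_zero hc), LSeries.term_of_ne_zero hc,
        one_convolution_vonMangoldt_indicator_divisors hd.ne' hc, Complex.cpow_neg,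
        div_eq_mul_inv]
  rw [hterm]
  exact ⟨hsum.summable, hsum.tsum_eq⟩
end

section
/- Let d be a positive integer and s, k ∈ ℂ with Re(s) > 1 and Re(s+k) > 1. Then ∑_{c=1}^∞ gcd(c,d)^k·c^{−s−k} = ζ(s+k)·∏_{p∣d, p prime} (1 + (1−p^{−k})·(p^{−s} + p^{−2s} + ⋯ + p^{−v_p(d)·s})), where the left-hand side converges absolutely and the product is over the prime divisors p of d. -/
/-- If `F e = q ^ min e v * x ^ e` is summable then
`∑ F e = (1 - x)⁻¹ * (1 + (1 - q⁻¹) * ∑_{j=1}^v (q x) ^ j)`. -/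
lemma tsum_pow_min_mul_pow (q x : ℂ) (v : ℕ) (hq : q ≠ 0) (hx : x ≠ 1)
    (hF : Summable fun e : ℕ => q ^ min e v * x ^ e) :
    ∑' e : ℕ, q ^ min e v * x ^ e =
      (1 - x)⁻¹ * (1 + (1 - q⁻¹) * ∑ j ∈ Finset.Icc 1 v, (q * x) ^ j) := by
  have hshift := hF.tsum_eq_zero_add
  have hdiff : ∑' e : ℕ, (q ^ min (e + 1) v * x ^ (e + 1) - x * (q ^ min e v * x ^ e)) =
      (1 - q⁻¹) * ∑ j ∈ Finset.Icc 1 v, (q * x) ^ j := by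
    rw [tsum_eq_sum (s := Finset.range v), Finset.mul_sum, Finset.range_eq_Ico,
      ← Finset.Ico_add_one_right_eq_Icc, ← Finset.sum_Ico_add' _ 0 v 1]
    · refine Finset.sum_congr rfl fun e he => ?_
      have hev : e < v := (Finset.mem_Ico.mp he).2
      rw [min_eq_left hev.le, min_eq_left (by omega : e + 1 ≤ v)]
      field_simp
      ring
    · intro e he
      have hve : v ≤ e := by simpa using he
      rw [min_eq_right hve, min_eq_right (by omega : v ≤ e + 1)]
      ring
  rw [((summable_nat_add_iff 1).mpr hF).tsum_sub (hF.mul_left x), tsum_mul_left] at hdiff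
  have hx' : 1 - x ≠ 0 := sub_ne_zero.mpr hx.symm
  rw [eq_inv_mul_iff_mul_eq₀ hx', ← hdiff]
  simp only [Nat.zero_min, pow_zero, mul_one] at hshift
  linear_combination hshift

/-- The summand `gcd(c, d) ^ k * c ^ (-s - k)` of the Dirichlet series, extended by `0` at `0`. -/
noncomputable def gcdPowTerm (d : ℕ) (s k : ℂ) (c : ℕ) : ℂ :=
  if 0 < c then (Nat.gcd c d : ℂ) ^ k * (c : ℂ) ^ (-s - k) else 0

lemma gcdPowTerm_zero (d : ℕ) (s k : ℂ) : gcdPowTerm d s k 0 = 0 := by simp [gcdPowTerm]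

lemma gcdPowTerm_one (d : ℕ) (s k : ℂ) : gcdPowTerm d s k 1 = 1 := by simp [gcdPowTerm]

lemma gcdPowTerm_mul_of_coprime (d : ℕ) (s k : ℂ) {m n : ℕ} (h : m.Coprime n) :
    gcdPowTerm d s k (m * n) = gcdPowTerm d s k m * gcdPowTerm d s k n := by
  rcases m.eq_zero_or_pos with rfl | hm
  · simp [gcdPowTerm]
  rcases n.eq_zero_or_pos with rfl | hn
  · simp [gcdPowTerm]
  have hgcd : Nat.gcd (m * n) d = Nat.gcd m d * Nat.gcd n d := by
    simpa only [Nat.gcd_comm d] using h.gcd_mul d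
  simp only [gcdPowTerm, Nat.mul_pos hm hn, hm, hn, if_true, hgcd, Nat.cast_mul,
    Complex.natCast_mul_natCast_cpow]
  ring

lemma summable_norm_gcdPowTerm {d : ℕ} (hd : 0 < d) {s k : ℂ} (hsk : 1 < (s + k).re) :
    Summable fun c => ‖gcdPowTerm d s k c‖ := by
  have hz : Summable fun c : ℕ => ‖(1 : ℂ) / (c : ℂ) ^ (s + k)‖ :=
    (Complex.summable_one_div_nat_cpow.mpr hsk).norm
  refine Summable.of_nonneg_of_le (fun _ => norm_nonneg _) (fun c => ?_)
    (hz.mul_left (∑ g ∈ d.divisors, ‖(g : ℂ) ^ k‖))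
  have hC : 0 ≤ ∑ g ∈ d.divisors, ‖(g : ℂ) ^ k‖ := Finset.sum_nonneg fun _ _ => norm_nonneg _
  unfold gcdPowTerm
  split_ifs with hc
  · rw [norm_mul, one_div, ← Complex.cpow_neg, neg_add']
    refine mul_le_mul_of_nonneg_right ?_ (norm_nonneg _)
    exact Finset.single_le_sum (f := fun g : ℕ => ‖(g : ℂ) ^ k‖) (fun _ _ => norm_nonneg _)
      (Nat.mem_divisors.mpr ⟨Nat.gcd_dvd_right c d, hd.ne'⟩)
  · rw [norm_zero]
    positivity

lemma gcd_prime_pow_eq {d p : ℕ} (hd : d ≠ 0) (hp : p.Prime) (e : ℕ) :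
    Nat.gcd (p ^ e) d = p ^ min e (d.factorization p) := by
  obtain ⟨i, hi, h⟩ := (Nat.dvd_prime_pow hp).mp (Nat.gcd_dvd_left (p ^ e) d)
  rw [h]
  congr 1
  refine le_antisymm (le_min hi ?_) ?_
  · exact (hp.pow_dvd_iff_le_factorization hd).mp (h ▸ Nat.gcd_dvd_right (p ^ e) d)
  · refine (Nat.pow_dvd_pow_iff_le_right hp.one_lt).mp (h ▸ Nat.dvd_gcd ?_ ?_)
    · exact pow_dvd_pow p (min_le_left _ _)
    · exact (hp.pow_dvd_iff_le_factorization hd).mpr (min_le_right _ _)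

lemma gcdPowTerm_prime_pow {d p : ℕ} (hd : d ≠ 0) (hp : p.Prime) (s k : ℂ) (e : ℕ) :
    gcdPowTerm d s k (p ^ e) =
      ((p : ℂ) ^ k) ^ min e (d.factorization p) * ((p : ℂ) ^ (-(s + k))) ^ e := by
  rw [gcdPowTerm, if_pos (pow_pos hp.pos e), gcd_prime_pow_eq hd hp, ← neg_add']
  simp only [Nat.cast_pow, ← Complex.natCast_cpow_natCast_mul, ← Complex.cpow_nat_mul]

/-- The local factor at `p` of `∑ gcd(c, d) ^ k * c ^ (-s - k)`. -/
lemma tsum_gcdPowTerm_prime_pow {d p : ℕ} (hd : 0 < d) (hp : p.Prime) {s k : ℂ}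
    (hsk : 1 < (s + k).re) :
    ∑' e : ℕ, gcdPowTerm d s k (p ^ e) = (1 - (p : ℂ) ^ (-(s + k)))⁻¹ *
      (1 + (1 - (p : ℂ) ^ (-k)) *
        ∑ j ∈ Finset.Icc 1 (d.factorization p), (p : ℂ) ^ (-(j : ℂ) * s)) := by
  have hp0 : (p : ℂ) ≠ 0 := Nat.cast_ne_zero.mpr hp.ne_zero
  have hsum := (summable_norm_gcdPowTerm hd hsk).of_norm.comp_injective
    (Nat.pow_right_injective hp.two_le)
  simp only [Function.comp_def, gcdPowTerm_prime_pow hd.ne' hp] at hsum ⊢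
  have hx : (p : ℂ) ^ (-(s + k)) ≠ 1 := by
    intro h
    have := Complex.norm_prime_cpow_le_one_half ⟨p, hp⟩ hsk
    rw [h, norm_one] at this
    norm_num at this
  rw [tsum_pow_min_mul_pow _ _ _ (by simp [Complex.cpow_eq_zero_iff, hp0]) hx hsum,
    Complex.cpow_neg _ k, ← Complex.cpow_add _ _ hp0]
  congr 4
  funext j
  rw [← Complex.cpow_nat_mul]
  congr 1
  ring


open scoped BigOperators

/-- For a positive integer `d` and `s, k ∈ ℂ` with `Re(s) > 1` and `Re(s+k) > 1`,
`∑_{c=1}^∞ gcd(c,d)^k·c^{−s−k}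
  = ζ(s+k)·∏_{p∣d} (1 + (1−p^{−k})·(p^{−s} + ⋯ + p^{−v_p(d)·s}))`,
with absolute convergence of the left-hand side. -/
theorem dirichlet_series_gcd_pow (d : ℕ) (hd : 0 < d) (s k : ℂ)
    (hs : 1 < s.re) (hsk : 1 < (s + k).re) :
    Summable (fun c : ℕ => if 0 < c then
        (Nat.gcd c d : ℂ) ^ k * (c : ℂ) ^ (-s - k) else 0) ∧
    (∑' c : ℕ, if 0 < c then (Nat.gcd c d : ℂ) ^ k * (c : ℂ) ^ (-s - k) else 0) =
      riemannZeta (s + k) *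
        ∏ p ∈ d.primeFactors,
          (1 + (1 - (p : ℂ) ^ (-k)) *
            ∑ j ∈ Finset.Icc 1 (d.factorization p), (p : ℂ) ^ (-(j : ℂ) * s)) := by
  have hsum := summable_norm_gcdPowTerm hd hsk
  refine ⟨hsum.of_norm, ?_⟩
  have hprod := EulerProduct.eulerProduct_hasProd (gcdPowTerm_one d s k)
    (gcdPowTerm_mul_of_coprime d s k) hsum (gcdPowTerm_zero d s k)
  simp only [fun p : Nat.Primes => tsum_gcdPowTerm_prime_pow hd p.2 hsk] at hprod
  have hfin : HasProd (fun p : Nat.Primes => 1 + (1 - (p : ℂ) ^ (-k)) *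
      ∑ j ∈ Finset.Icc 1 (d.factorization p), (p : ℂ) ^ (-(j : ℂ) * s))
      (∏ p ∈ d.primeFactors.subtype Nat.Prime, (1 + (1 - ((p : ℕ) : ℂ) ^ (-k)) *
        ∑ j ∈ Finset.Icc 1 (d.factorization p), ((p : ℕ) : ℂ) ^ (-(j : ℂ) * s))) := by
    refine hasProd_prod_of_ne_finset_one fun p hp => ?_
    have hv : d.factorization p = 0 := by
      rw [← Finsupp.notMem_support_iff, Nat.support_factorization]
      exact fun h => hp (Finset.mem_subtype.mpr h)
    simp [hv]
  rw [Finset.prod_subtype_of_mem (fun p : ℕ => 1 + (1 - (p : ℂ) ^ (-k)) *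
    ∑ j ∈ Finset.Icc 1 (d.factorization p), (p : ℂ) ^ (-(j : ℂ) * s))
    fun p hp => Nat.prime_of_mem_primeFactors hp] at hfin
  exact hprod.unique ((riemannZeta_eulerProduct_hasProd hsk).mul hfin)
end

section
/- Let d be a positive integer and r₁ ∈ ℂ. The function H(t₂) = ∏_{p∣d, p prime} (1 + (1−p^{−t₂})·(p^{r₁+t₂} + p^{2(r₁+t₂)} + ⋯ + p^{v_p(d)·(r₁+t₂)})) is differentiable at t₂ = 0, with H(0) = 1 and H'(0) = ∑_{ℓ∈ℕ, ℓ∣d} Λ(ℓ)·ℓ^{r₁}. Consequently, for r₁ ≠ −1, the derivative at t₂ = 0 of t₂ ↦ ζ(−r₁)·H(t₂) equals ζ(−r₁)·∑_{ℓ∣d} Λ(ℓ)·ℓ^{r₁}. -/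
open scoped BigOperators

/-- A sum over divisors weighted by the von Mangoldt function is a sum over the prime powers
dividing `d`. -/
theorem sum_divisors_vonMangoldt_mul {d : ℕ} (hd : d ≠ 0) (f : ℕ → ℂ) :
    ∑ ℓ ∈ d.divisors, (ArithmeticFunction.vonMangoldt ℓ : ℂ) * f ℓ =
      ∑ p ∈ d.primeFactors, ∑ j ∈ Finset.Icc 1 (d.factorization p),
        (Real.log p : ℂ) * f (p ^ j) := by
  rw [Finset.sum_sigma']
  symm
  refine Finset.sum_of_injOn (fun x => x.1 ^ x.2) ?_ ?_ ?_ ?_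
  · rintro ⟨p, j⟩ hx ⟨q, k⟩ hy h
    simp only [Finset.coe_sigma, Set.mem_sigma_iff, Finset.mem_coe, Nat.mem_primeFactors,
      Finset.mem_Icc] at hx hy h
    obtain ⟨rfl, rfl⟩ := hx.1.1.pow_inj' hy.1.1 (by lia) (by lia) h
    rfl
  · rintro ⟨p, j⟩ hx
    simp only [Finset.coe_sigma, Set.mem_sigma_iff, Finset.mem_coe, Nat.mem_primeFactors,
      Finset.mem_Icc] at hx
    simpa [hd] using (hx.1.1.pow_dvd_iff_le_factorization hd).2 hx.2.2
  · intro ℓ hℓ hn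
    have hpow : ¬ IsPrimePow ℓ := by
      intro h
      obtain ⟨p, k, hp, hk, rfl⟩ := (isPrimePow_nat_iff ℓ).1 h
      have hdvd : p ^ k ∣ d := Nat.dvd_of_mem_divisors hℓ
      refine hn ⟨⟨p, k⟩, ?_, rfl⟩
      simp only [Finset.coe_sigma, Set.mem_sigma_iff, Finset.mem_coe, Nat.mem_primeFactors,
        Finset.mem_Icc]
      exact ⟨⟨hp, (dvd_pow_self p hk.ne').trans hdvd, hd⟩, hk,
        (hp.pow_dvd_iff_le_factorization hd).1 hdvd⟩
    simp [ArithmeticFunction.vonMangoldt_eq_zero_iff.2 hpow]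
  · rintro ⟨p, j⟩ hx
    simp only [Finset.mem_sigma, Nat.mem_primeFactors, Finset.mem_Icc] at hx
    rw [ArithmeticFunction.vonMangoldt_apply_pow (by lia),
      ArithmeticFunction.vonMangoldt_apply_prime hx.1.1]

/-- The derivative at `0` of a local factor `1 + (1 - p ^ (-t)) * ∑ j, p ^ (j * (r + t))`. -/
theorem hasDerivAt_local_factor {p : ℕ} (hp : p ≠ 0) (s : Finset ℕ) (r : ℂ) :
    HasDerivAt (fun t : ℂ => 1 + (1 - (p : ℂ) ^ (-t)) * ∑ j ∈ s, (p : ℂ) ^ ((j : ℂ) * (r + t)))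
      (∑ j ∈ s, (Real.log p : ℂ) * ((p ^ j : ℕ) : ℂ) ^ r) 0 := by
  have hp' : (p : ℂ) ≠ 0 := Nat.cast_ne_zero.2 hp
  have hleft : HasDerivAt (fun t : ℂ => 1 - (p : ℂ) ^ (-t)) (Real.log p : ℂ) 0 := by
    simpa [Complex.natCast_log] using
      ((hasDerivAt_neg (0 : ℂ)).const_cpow (c := (p : ℂ)) (Or.inl hp')).const_sub 1
  have hright : DifferentiableAt ℂ (fun t : ℂ => ∑ j ∈ s, (p : ℂ) ^ ((j : ℂ) * (r + t))) 0 :=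
    DifferentiableAt.fun_sum fun j _ =>
      DifferentiableAt.const_cpow (by fun_prop) (Or.inl hp')
  refine ((hleft.fun_mul hright.hasDerivAt).const_add 1).congr_deriv ?_
  simp [Finset.mul_sum, Complex.natCast_cpow_natCast_mul]

/-- For a positive integer `d` and `r₁ ∈ ℂ`, the function
`H(t₂) = ∏_{p∣d} (1 + (1−p^{−t₂})·(p^{r₁+t₂} + ⋯ + p^{v_p(d)·(r₁+t₂)}))` satisfies
`H(0) = 1` and is differentiable at `t₂ = 0` with `H'(0) = ∑_{ℓ∣d} Λ(ℓ)·ℓ^{r₁}`;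
consequently, for `r₁ ≠ −1`, the derivative of `t₂ ↦ ζ(−r₁)·H(t₂)` at `t₂ = 0` is
`ζ(−r₁)·∑_{ℓ∣d} Λ(ℓ)·ℓ^{r₁}`. -/
theorem deriv_gcd_euler_product (d : ℕ) (hd : 0 < d) (r₁ : ℂ) :
    (fun t₂ : ℂ => ∏ p ∈ d.primeFactors,
        (1 + (1 - (p : ℂ) ^ (-t₂)) *
          ∑ j ∈ Finset.Icc 1 (d.factorization p), (p : ℂ) ^ ((j : ℂ) * (r₁ + t₂)))) 0 = 1 ∧
    HasDerivAt (fun t₂ : ℂ => ∏ p ∈ d.primeFactors,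
        (1 + (1 - (p : ℂ) ^ (-t₂)) *
          ∑ j ∈ Finset.Icc 1 (d.factorization p), (p : ℂ) ^ ((j : ℂ) * (r₁ + t₂))))
      (∑ ℓ ∈ d.divisors, (ArithmeticFunction.vonMangoldt ℓ : ℂ) * (ℓ : ℂ) ^ r₁) 0 ∧
    (r₁ ≠ -1 → HasDerivAt (fun t₂ : ℂ => riemannZeta (-r₁) *
        ∏ p ∈ d.primeFactors,
          (1 + (1 - (p : ℂ) ^ (-t₂)) *
            ∑ j ∈ Finset.Icc 1 (d.factorization p), (p : ℂ) ^ ((j : ℂ) * (r₁ + t₂))))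
      (riemannZeta (-r₁) *
        ∑ ℓ ∈ d.divisors, (ArithmeticFunction.vonMangoldt ℓ : ℂ) * (ℓ : ℂ) ^ r₁) 0) := by
  have hderiv : HasDerivAt (fun t₂ : ℂ => ∏ p ∈ d.primeFactors,
        (1 + (1 - (p : ℂ) ^ (-t₂)) *
          ∑ j ∈ Finset.Icc 1 (d.factorization p), (p : ℂ) ^ ((j : ℂ) * (r₁ + t₂))))
      (∑ ℓ ∈ d.divisors, (ArithmeticFunction.vonMangoldt ℓ : ℂ) * (ℓ : ℂ) ^ r₁) 0 := by
    rw [sum_divisors_vonMangoldt_mul hd.ne' fun ℓ => (ℓ : ℂ) ^ r₁]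
    refine (HasDerivAt.fun_finsetProd fun p hp =>
      hasDerivAt_local_factor (Nat.prime_of_mem_primeFactors hp).ne_zero
        (Finset.Icc 1 (d.factorization p)) r₁).congr_deriv ?_
    simp
  exact ⟨by simp, hderiv, fun _ => hderiv.const_mul _⟩
end

section
/- Let n be a nonzero integer, c and d positive integers, and f : ℤ → ℂ with ∑_{j∈ℤ}|f(j)| < ∞. If gcd(c,d) ∤ n, then there is no pair of nonzero integers (a,b) with ad − bc = n, so ∑_{a,b∈ℤ∖{0}, ad−bc=n} f(bc) = 0. If gcd(c,d) ∣ n, then ∑_{a,b∈ℤ∖{0}, ad−bc=n} f(bc) = ∑_{m∈ℤ} f((b* + m·d/gcd(c,d))·c) − δ_{c∣n}·f(−n) − δ_{d∣n}·f(0), where δ_{c∣n} is 1 if c ∣ n and 0 otherwise (similarly δ_{d∣n}), and all sums converge absolutely. Equivalently, since (b* + m·d/gcd(c,d))·c = (m+u_{c,d})·v_{c,d}, the right-hand side is ∑_{m∈ℤ} f((m+u_{c,d})·v_{c,d}) − δ_{c∣n}·f(−n) − δ_{d∣n}·f(0). -/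
open scoped BigOperators

/-- The integer solutions of `a * d - b * c = n` form the orbit of any one solution under
translation by `(c / gcd c d, d / gcd c d)`. -/
lemma linear_solution_iff {n : ℤ} {c d : ℕ} (hd : 0 < d) {a₀ b₀ : ℤ}
    (h₀ : a₀ * d - b₀ * c = n) (a b : ℤ) :
    a * d - b * c = n ↔ ∃ m : ℤ, a = a₀ + m * ((c / Nat.gcd c d : ℕ) : ℤ) ∧
      b = b₀ + m * ((d / Nat.gcd c d : ℕ) : ℤ) := by
  have hg : 0 < Nat.gcd c d := Nat.gcd_pos_of_pos_right c hd
  have hcop := Nat.coprime_div_gcd_div_gcd hg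
  have hc' := Nat.div_mul_cancel (Nat.gcd_dvd_left c d)
  have hd' := Nat.div_mul_cancel (Nat.gcd_dvd_right c d)
  generalize Nat.gcd c d = g at *
  generalize c / g = p at *
  generalize d / g = q at *
  subst hc' hd'
  have hg0 : (g : ℤ) ≠ 0 := by exact_mod_cast hg.ne'
  have hq0 : (q : ℤ) ≠ 0 := by
    exact_mod_cast (Nat.pos_of_mul_pos_right hd).ne'
  push_cast at *
  constructor
  · intro h
    have key : (a - a₀) * q = (b - b₀) * p := by
      apply mul_right_cancel₀ hg0
      linear_combination h - h₀
    have hdvd : (q : ℤ) ∣ b - b₀ :=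
      (Nat.isCoprime_iff_coprime.mpr hcop).symm.dvd_of_dvd_mul_right ⟨a - a₀, by rw [← key]; ring⟩
    obtain ⟨m, hm⟩ := hdvd
    refine ⟨m, ?_, by linear_combination hm⟩
    apply mul_right_cancel₀ hq0
    linear_combination key + p * hm
  · rintro ⟨m, rfl, rfl⟩
    linear_combination h₀

/-- Summing over all solutions of `a * d - b * c = n` amounts to summing over the orbit of one
solution. -/
lemma hasSum_linear_solutions {n : ℤ} {c d : ℕ} (hd : 0 < d) {a₀ b₀ : ℤ}
    (h₀ : a₀ * d - b₀ * c = n) {f : ℤ → ℂ}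
    (hf : Summable fun m : ℤ => f ((b₀ + m * ((d / Nat.gcd c d : ℕ) : ℤ)) * c)) :
    HasSum (fun ab : ℤ × ℤ => if ab.1 * d - ab.2 * c = n then f (ab.2 * c) else 0)
      (∑' m : ℤ, f ((b₀ + m * ((d / Nat.gcd c d : ℕ) : ℤ)) * c)) := by
  have hq : ((d / Nat.gcd c d : ℕ) : ℤ) ≠ 0 := by
    exact_mod_cast (Nat.div_pos (Nat.gcd_le_right c hd) (Nat.gcd_pos_of_pos_right c hd)).ne'
  let φ : ℤ → ℤ × ℤ := fun m =>
    (a₀ + m * ((c / Nat.gcd c d : ℕ) : ℤ), b₀ + m * ((d / Nat.gcd c d : ℕ) : ℤ))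
  have hφ : Function.Injective φ := fun m m' h =>
    mul_right_cancel₀ hq (add_left_cancel (Prod.ext_iff.mp h).2)
  rw [← hφ.hasSum_iff]
  · refine hf.hasSum.congr_fun fun m => ?_
    exact if_pos ((linear_solution_iff hd h₀ _ _).mpr ⟨m, rfl, rfl⟩)
  · rintro ⟨a, b⟩ hab
    refine if_neg fun h => hab ?_
    obtain ⟨m, ha, hb⟩ := (linear_solution_iff hd h₀ a b).mp h
    exact ⟨m, Prod.ext ha.symm hb.symm⟩

/-- Removing the at most two solutions with a vanishing coordinate. -/
lemma ite_nonzero_solution_eq {n : ℤ} (hn : n ≠ 0) {c d : ℕ} (hc : 0 < c) (hd : 0 < d)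
    (f : ℤ → ℂ) (ab : ℤ × ℤ) :
    (if ab.1 ≠ 0 ∧ ab.2 ≠ 0 ∧ ab.1 * d - ab.2 * c = n then f (ab.2 * c) else 0) =
      (if ab.1 * d - ab.2 * c = n then f (ab.2 * c) else 0)
        - (if ab = (0, -(n / c)) then (if (c : ℤ) ∣ n then f (-n) else 0) else 0)
        - (if ab = (n / d, 0) then (if (d : ℤ) ∣ n then f 0 else 0) else 0) := by
  obtain ⟨a, b⟩ := ab
  have hc0 : (c : ℤ) ≠ 0 := by exact_mod_cast hc.ne'
  have hd0 : (d : ℤ) ≠ 0 := by exact_mod_cast hd.ne'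
  simp only [Prod.mk.injEq, ← ite_and]
  have hA : ((a = 0 ∧ b = -(n / c)) ∧ (c : ℤ) ∣ n) ↔ a = 0 ∧ a * d - b * c = n := by
    constructor
    · rintro ⟨⟨rfl, rfl⟩, h⟩
      exact ⟨rfl, by linear_combination Int.ediv_mul_cancel h⟩
    · rintro ⟨rfl, h⟩
      have h' : n = -b * c := by linear_combination -h
      exact ⟨⟨rfl, by rw [h', Int.mul_ediv_cancel _ hc0, neg_neg]⟩, -b, by rw [h', mul_comm]⟩
  have hB : ((a = n / d ∧ b = 0) ∧ (d : ℤ) ∣ n) ↔ b = 0 ∧ a * d - b * c = n := by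
    constructor
    · rintro ⟨⟨rfl, rfl⟩, h⟩
      exact ⟨rfl, by linear_combination Int.ediv_mul_cancel h⟩
    · rintro ⟨rfl, h⟩
      have h' : n = a * d := by linear_combination -h
      exact ⟨⟨by rw [h', Int.mul_ediv_cancel _ hd0], rfl⟩, a, by rw [h', mul_comm]⟩
  simp only [hA, hB]
  by_cases h : a * d - b * c = n
  · by_cases ha : a = 0
    · have hb : b ≠ 0 := by
        rintro rfl
        exact hn (by rw [← h, ha]; ring)
      have hbc : b * c = -n := by rw [← h, ha]; ring
      simp [ha, hb, hbc]
    · by_cases hb : b = 0 <;> simp_all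
  · simp [h]

/-- Rewriting of the sum `∑_{a,b∈ℤ∖{0}, ad−bc=n} f(bc)` (Lemma 2.4 of the paper):
it vanishes when `gcd(c,d) ∤ n`, and when `gcd(c,d) ∣ n` it equals
`∑_{m∈ℤ} f((b* + m·d/gcd(c,d))·c) − δ_{c∣n}·f(−n) − δ_{d∣n}·f(0)`; moreover
`(b* + m·d/gcd(c,d))·c = (m + u_{c,d})·v_{c,d}` with `v_{c,d} = c·d/gcd(c,d)`. -/
theorem pair_sum_rewrite (n : ℤ) (hn : n ≠ 0) (c d : ℕ) (hc : 0 < c) (hd : 0 < d)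
    (f : ℤ → ℂ) (hf : Summable fun j : ℤ => ‖f j‖) :
    (¬ (Nat.gcd c d : ℤ) ∣ n →
      (¬ ∃ a b : ℤ, a ≠ 0 ∧ b ≠ 0 ∧ a * d - b * c = n) ∧
      (∑' ab : ℤ × ℤ, if ab.1 ≠ 0 ∧ ab.2 ≠ 0 ∧ ab.1 * d - ab.2 * c = n
          then f (ab.2 * c) else 0) = 0) ∧
    ((Nat.gcd c d : ℤ) ∣ n → ∀ b₀ : ℤ, IsMinAbsB n c d b₀ →
      Summable (fun ab : ℤ × ℤ => ‖if ab.1 ≠ 0 ∧ ab.2 ≠ 0 ∧ ab.1 * d - ab.2 * c = n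
          then f (ab.2 * c) else 0‖) ∧
      Summable (fun m : ℤ => ‖f ((b₀ + m * ((d / Nat.gcd c d : ℕ) : ℤ)) * c)‖) ∧
      (∑' ab : ℤ × ℤ, if ab.1 ≠ 0 ∧ ab.2 ≠ 0 ∧ ab.1 * d - ab.2 * c = n
          then f (ab.2 * c) else 0) =
        (∑' m : ℤ, f ((b₀ + m * ((d / Nat.gcd c d : ℕ) : ℤ)) * c))
          - (if (c : ℤ) ∣ n then f (-n) else 0) - (if (d : ℤ) ∣ n then f 0 else 0) ∧
      (∀ m : ℤ, (((b₀ + m * ((d / Nat.gcd c d : ℕ) : ℤ)) * c : ℤ) : ℝ) =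
        ((m : ℝ) + uval c d b₀) * ((c * d / Nat.gcd c d : ℕ) : ℝ))) := by
  have hc0 : (c : ℤ) ≠ 0 := by exact_mod_cast hc.ne'
  have hg : 0 < Nat.gcd c d := Nat.gcd_pos_of_pos_right c hd
  have hq : ((d / Nat.gcd c d : ℕ) : ℤ) ≠ 0 := by
    exact_mod_cast (Nat.div_pos (Nat.gcd_le_right c hd) hg).ne'
  constructor
  · intro hndvd
    have hno : ∀ a b : ℤ, a * d - b * c ≠ n := fun a b h => hndvd <| h ▸ dvd_sub
      ((Int.natCast_dvd_natCast.mpr (Nat.gcd_dvd_right c d)).mul_left a)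
      ((Int.natCast_dvd_natCast.mpr (Nat.gcd_dvd_left c d)).mul_left b)
    exact ⟨fun ⟨a, b, _, _, h⟩ => hno a b h, by simp [hno]⟩
  · rintro - b₀ ⟨⟨a₀, h₀⟩, -⟩
    have hinj : Function.Injective
        fun m : ℤ => (b₀ + m * ((d / Nat.gcd c d : ℕ) : ℤ)) * c := fun m m' h =>
      mul_right_cancel₀ hq (add_left_cancel (mul_right_cancel₀ hc0 h))
    have hsum : Summable fun m : ℤ => ‖f ((b₀ + m * ((d / Nat.gcd c d : ℕ) : ℤ)) * c)‖ :=
      hf.comp_injective hinj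
    have hF := (((hasSum_linear_solutions hd h₀ hsum.of_norm).sub
      (hasSum_ite_eq (0, -(n / c)) (if (c : ℤ) ∣ n then f (-n) else 0))).sub
      (hasSum_ite_eq (n / d, 0) (if (d : ℤ) ∣ n then f 0 else 0))).congr_fun
      fun ab => ite_nonzero_solution_eq hn hc hd f ab
    refine ⟨hF.summable.norm, hsum, hF.tsum_eq, fun m => ?_⟩
    have hgR : (Nat.gcd c d : ℝ) ≠ 0 := by exact_mod_cast hg.ne'
    have hdR : (d : ℝ) ≠ 0 := by exact_mod_cast hd.ne'
    rw [uval, Nat.cast_div ((Nat.gcd_dvd_left c d).mul_right d) hgR]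
    rw [Int.cast_mul, Int.cast_add, Int.cast_mul, Int.cast_natCast, Int.cast_natCast,
      Nat.cast_div (Nat.gcd_dvd_right c d) hgR]
    push_cast
    field_simp
    ring
end

section
/- Let a be a real number with 0 < a < 1 and let s be an integer with s ≥ 2. Then the bilateral sum ∑_{m∈ℤ} (m+a)^{−s}·log|m+a| converges absolutely and equals −ζ_s'(s,a) − (−1)^s·ζ_s'(s,1−a), where ζ_s'(s₀,a) denotes the derivative in the first variable of the Hurwitz zeta function ζ(s,a) evaluated at s = s₀. -/
open scoped BigOperators

/-- The termwise derivative of the Dirichlet series of the Hurwitz zeta function. -/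
theorem hasSum_cpow_mul_log_hzeta {a : ℝ} (ha0 : 0 < a) (ha1 : a ≤ 1) {z : ℂ} (hz : 1 < z.re) :
    HasSum (fun n : ℕ => ((n + a : ℝ) : ℂ) ^ (-z) * ((Real.log (n + a) : ℝ) : ℂ))
      (-deriv (fun w : ℂ => hzeta w a) z) := by
  obtain ⟨r, hr1, hrz⟩ := exists_between hz
  have hpos (n : ℕ) : 0 < (n + a : ℝ) := by positivity
  let U : Set ℂ := {w | r < w.re} ∩ {w | w.re < z.re + 1}
  have hU : IsOpen U :=
    (isOpen_lt continuous_const Complex.continuous_re).inter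
      (isOpen_lt Complex.continuous_re continuous_const)
  have hzU : z ∈ U := ⟨hrz, lt_add_one z.re⟩
  have hsum {t : ℝ} (ht : 1 < t) : Summable fun n : ℕ => (n + a : ℝ) ^ (-t) := by
    refine ((Real.summable_one_div_nat_add_rpow a t).mpr ht).congr fun n => ?_
    rw [abs_of_pos (hpos n), Real.rpow_neg (hpos n).le, one_div]
  have hderiv (n : ℕ) (w : ℂ) : HasDerivAt (fun w : ℂ => ((n + a : ℝ) : ℂ) ^ (-w))
      (-(((n + a : ℝ) : ℂ) ^ (-w) * ((Real.log (n + a) : ℝ) : ℂ))) w := by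
    have h := (hasDerivAt_neg w).const_cpow (c := ((n + a : ℝ) : ℂ))
      (Or.inl (Complex.ofReal_ne_zero.mpr (hpos n).ne'))
    rwa [← Complex.ofReal_log (hpos n).le, mul_neg_one] at h
  have hbound (n : ℕ) (w : ℂ) (hw : w ∈ U) : ‖((n + a : ℝ) : ℂ) ^ (-w)‖ ≤
      (n + a : ℝ) ^ (-r) + (n + a : ℝ) ^ (-(z.re + 1)) := by
    rw [Complex.norm_cpow_eq_rpow_re_of_pos (hpos n), Complex.neg_re]
    rcases le_total 1 (n + a : ℝ) with h | h
    · exact (Real.rpow_le_rpow_of_exponent_le h (neg_le_neg hw.1.le)).trans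
        (le_add_of_nonneg_right (Real.rpow_nonneg (hpos n).le _))
    · exact (Real.rpow_le_rpow_of_exponent_ge (hpos n) h (neg_le_neg hw.2.le)).trans
        (le_add_of_nonneg_left (Real.rpow_nonneg (hpos n).le _))
  have key := Complex.hasSum_deriv_of_summable_norm
    ((hsum hr1).add (hsum (by linarith : 1 < z.re + 1)))
    (fun n w _ => (hderiv n w).differentiableAt.differentiableWithinAt) hU hbound hzU
  have heq : (fun w : ℂ => ∑' n : ℕ, ((n + a : ℝ) : ℂ) ^ (-w)) =ᶠ[nhds z]
      fun w => hzeta w a := by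
    filter_upwards [hU.mem_nhds hzU] with w hw
    rw [hzeta, ← (HurwitzZeta.hasSum_hurwitzZeta_of_one_lt_re ⟨ha0.le, ha1⟩
      (hr1.trans hw.1)).tsum_eq]
    simp [Complex.cpow_neg]
  rw [heq.deriv_eq] at key
  simp_rw [(hderiv _ z).deriv] at key
  simpa using key.neg

/-- For real `a ∈ (0,1)` and an integer `s ≥ 2`, the bilateral sum
`∑_{m∈ℤ} (m+a)^{−s}·log|m+a|` converges absolutely and equals
`−ζ_s'(s,a) − (−1)^s·ζ_s'(s,1−a)`, where `ζ_s'` is the derivative of the Hurwitz zeta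
function in its first variable. -/
theorem bilateral_log_sum_eq_hurwitz_deriv (a : ℝ) (ha0 : 0 < a) (ha1 : a < 1)
    (s : ℤ) (hs : 2 ≤ s) :
    Summable (fun m : ℤ => ((m : ℝ) + a) ^ (-s) * Real.log |(m : ℝ) + a|) ∧
    ((∑' m : ℤ, ((m : ℝ) + a) ^ (-s) * Real.log |(m : ℝ) + a| : ℝ) : ℂ) =
      - deriv (fun z : ℂ => hzeta z a) (s : ℂ)
        - (-1 : ℂ) ^ s * deriv (fun z : ℂ => hzeta z (1 - a)) (s : ℂ) := by
  have hcast (b : ℝ) (n : ℕ) : ((n + b : ℝ) : ℂ) ^ (-(s : ℂ)) =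
      (((n + b : ℝ) ^ (-s) : ℝ) : ℂ) := by
    rw [← Int.cast_neg, Complex.cpow_intCast, Complex.ofReal_zpow]
  have hre : 1 < (s : ℂ).re := by
    rw [Complex.intCast_re]
    exact_mod_cast hs
  have hright := hasSum_cpow_mul_log_hzeta ha0 ha1.le hre
  have hleft := (hasSum_cpow_mul_log_hzeta (sub_pos.mpr ha1) (sub_le_self 1 ha0.le) hre).mul_left
    ((-1 : ℂ) ^ s)
  have key : HasSum
      (fun m : ℤ => ((((m : ℝ) + a) ^ (-s) * Real.log |(m : ℝ) + a| : ℝ) : ℂ))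
      (-deriv (fun z : ℂ => hzeta z a) s +
        (-1 : ℂ) ^ s * -deriv (fun z : ℂ => hzeta z (1 - a)) s) := by
    refine HasSum.of_nat_of_neg_add_one (hright.congr_fun fun n => ?_)
      (hleft.congr_fun fun n => ?_)
    · rw [hcast, Int.cast_natCast, abs_of_pos (by positivity), Complex.ofReal_mul]
    · have hx : 0 < (n + (1 - a) : ℝ) := add_pos_of_nonneg_of_pos n.cast_nonneg (sub_pos.mpr ha1)
      have hneg : (((-(n + 1 : ℤ) : ℤ) : ℝ) + a) = -1 * (n + (1 - a)) := by
        push_cast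
        ring
      rw [hcast, hneg, mul_zpow, neg_one_mul, abs_neg, abs_of_pos hx,
        zpow_neg (-1 : ℝ), ← inv_zpow, inv_neg_one]
      push_cast
      ring
  refine ⟨Complex.summable_ofReal.mp key.summable, ?_⟩
  rw [Complex.ofReal_tsum, key.tsum_eq]
  ring
end
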